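/- arXiv:2507.18118 — 8 statements merged into one kernel-verified Lean document; each statement's English description precedes it below -/
import Mathlib

section
/- Under consistency (Y = A·Y¹ + (1−A)·Y⁰ a.s.), unconfoundedness (σ(A) conditionally independent of σ(Y⁰, Y¹) given σ(X)), and a propensity score b₁ satisfying positivity with margin ε ∈ (0, 1/2), the average treatment effect is identified by inverse propensity weighting: E[Y¹ − Y⁰] = E[A·Y/b₁(X) − (1−A)·Y/(1 − b₁(X))]. -/
open MeasureTheory ProbabilityTheory

/-- The conditional expectation of a product of conditionally independent real random variables is
the product of their conditional expectations. -/
theorem ProbabilityTheory.CondIndepFun.condExp_mul {Ω : Type*} {m' mΩ : MeasurableSpace Ω}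
    [StandardBorelSpace Ω] {hm' : m' ≤ mΩ} {μ : Measure Ω} [IsFiniteMeasure μ] {f g : Ω → ℝ}
    (h : CondIndepFun m' hm' f g μ) (hfm : Measurable f) (hgm : Measurable g)
    (hf : Integrable f μ) (hg : Integrable g μ) (hfg : Integrable (f * g) μ) :
    μ[f * g | m'] =ᵐ[μ] μ[f | m'] * μ[g | m'] := by
  have hprod := ae_of_ae_trim hm' ((condIndepFun_iff_map_prod_eq_prod_map_map hfm hgm).1 h)
  filter_upwards [hprod, condExp_ae_eq_integral_condExpKernel hm' hf,
    condExp_ae_eq_integral_condExpKernel hm' hg,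
    condExp_ae_eq_integral_condExpKernel hm' hfg] with ω hω h₁ h₂ h₃
  have hindep : IndepFun f g (condExpKernel μ m' ω) := by
    rw [indepFun_iff_map_prod_eq_prod_map_map hfm.aemeasurable hgm.aemeasurable]
    rwa [Kernel.map_apply _ (hfm.prodMk hgm), Kernel.prod_apply, Kernel.map_apply _ hfm,
      Kernel.map_apply _ hgm] at hω
  rw [Pi.mul_apply, h₁, h₂, h₃]
  exact hindep.integral_mul_eq_mul_integral hfm.aestronglyMeasurable hgm.aestronglyMeasurable

/-- Weighting by the inverse `p⁻¹` of the conditional mean of a bounded `f` recovers the mean of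
any integrable `g` that is conditionally independent of `f`. -/
theorem ProbabilityTheory.CondIndepFun.integral_inv_mul_mul {Ω : Type*}
    {m' mΩ : MeasurableSpace Ω} [StandardBorelSpace Ω] {hm' : m' ≤ mΩ} {μ : Measure Ω}
    [IsFiniteMeasure μ] {f g p : Ω → ℝ} (h : CondIndepFun m' hm' f g μ)
    (hfm : Measurable f) (hgm : Measurable g) (hg : Integrable g μ)
    {c : ℝ} (hfc : ∀ ω, ‖f ω‖ ≤ c) (hpm : Measurable[m'] p) (hp : p =ᵐ[μ] μ[f | m'])
    {ε : ℝ} (hε : 0 < ε) (hεp : ∀ ω, ε ≤ p ω) :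
    Integrable (fun ω ↦ (p ω)⁻¹ * (f ω * g ω)) μ ∧
      ∫ ω, (p ω)⁻¹ * (f ω * g ω) ∂μ = ∫ ω, g ω ∂μ := by
  have hf : Integrable f μ := .of_bound hfm.aestronglyMeasurable c (.of_forall hfc)
  have hfg : Integrable (f * g) μ := hg.bdd_mul hfm.aestronglyMeasurable (.of_forall hfc)
  have hbound : ∀ ω, ‖(p ω)⁻¹‖ ≤ ε⁻¹ := fun ω ↦ by
    rw [norm_inv, Real.norm_of_nonneg (hε.le.trans (hεp ω))]
    exact inv_anti₀ hε (hεp ω)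
  have hpinv : StronglyMeasurable[m'] (fun ω ↦ (p ω)⁻¹) := (Measurable.inv hpm).stronglyMeasurable
  refine ⟨hfg.bdd_mul (hpinv.mono hm').aestronglyMeasurable (.of_forall hbound), ?_⟩
  have hpull := condExp_stronglyMeasurable_mul_of_bound hm' hpinv hfg _ (.of_forall hbound)
  calc ∫ ω, (p ω)⁻¹ * (f ω * g ω) ∂μ
    _ = ∫ ω, (μ[(fun ω ↦ (p ω)⁻¹) * (f * g) | m']) ω ∂μ := (integral_condExp hm').symm
    _ = ∫ ω, (μ[g | m']) ω ∂μ := by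
      refine integral_congr_ae ?_
      filter_upwards [hpull, h.condExp_mul hfm hgm hf hg hfg, hp] with ω h₁ h₂ h₃
      rw [h₁, Pi.mul_apply, h₂, Pi.mul_apply, ← h₃,
        inv_mul_cancel_left₀ (hε.trans_le (hεp ω)).ne']
    _ = ∫ ω, g ω ∂μ := integral_condExp hm'

/-- **IPW identification of the ATE.** Under consistency, unconfoundedness and positivity of
the propensity score `b₁`, the average treatment effect `E[Y¹ − Y⁰]` equals
`E[A·Y/b₁(X) − (1−A)·Y/(1 − b₁(X))]`. -/
theorem ipw_identification_of_ate
    {Ω 𝒳 : Type*} [MeasurableSpace Ω] [StandardBorelSpace Ω] [MeasurableSpace 𝒳]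
    (μ : Measure Ω) [IsProbabilityMeasure μ]
    (X : Ω → 𝒳) (hX : Measurable X)
    (A : Ω → ℝ) (hA : Measurable A) (hA01 : ∀ ω, A ω = 0 ∨ A ω = 1)
    (Y Y0 Y1 : Ω → ℝ)
    (hY : Integrable Y μ) (hY0 : Integrable Y0 μ) (hY1 : Integrable Y1 μ)
    (hY0m : Measurable Y0) (hY1m : Measurable Y1)
    (b₁ : 𝒳 → ℝ) (hb₁ : Measurable b₁)
    -- `b₁ ∘ X` is a version of the conditional expectation `E[A | σ(X)]`
    (hps : (fun ω => b₁ (X ω)) =ᵐ[μ] μ[A | MeasurableSpace.comap X inferInstance])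
    -- positivity with margin `ε ∈ (0, 1/2)`
    (ε : ℝ) (hε : ε ∈ Set.Ioo (0 : ℝ) (1/2))
    (hpos : ∀ x, ε ≤ b₁ x ∧ b₁ x ≤ 1 - ε)
    -- consistency: `Y = A·Y¹ + (1 − A)·Y⁰` almost surely
    (hcons : ∀ᵐ ω ∂μ, Y ω = A ω * Y1 ω + (1 - A ω) * Y0 ω)
    -- unconfoundedness: `σ(A)` is conditionally independent of `σ(Y⁰, Y¹)` given `σ(X)`
    (hunconf : CondIndep (MeasurableSpace.comap X inferInstance)
      (MeasurableSpace.comap A inferInstance)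
      (MeasurableSpace.comap (fun ω => (Y0 ω, Y1 ω)) inferInstance)
      hX.comap_le μ) :
    ∫ ω, (Y1 ω - Y0 ω) ∂μ =
      ∫ ω, (A ω * Y ω / b₁ (X ω) - (1 - A ω) * Y ω / (1 - b₁ (X ω))) ∂μ := by
  have hXY : CondIndepFun (MeasurableSpace.comap X inferInstance) hX.comap_le A
      (fun ω ↦ (Y0 ω, Y1 ω)) μ :=
    (condIndepFun_iff_condIndep ..).2 hunconf
  have hbX : Measurable[MeasurableSpace.comap X inferInstance] fun ω ↦ b₁ (X ω) :=
    hb₁.comp (comap_measurable X)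
  have hA_int : Integrable A μ := .of_bound hA.aestronglyMeasurable 1 <|
    .of_forall fun ω ↦ by rcases hA01 ω with h | h <;> simp [h]
  have hps' : (fun ω ↦ 1 - b₁ (X ω)) =ᵐ[μ]
      μ[fun ω ↦ 1 - A ω | MeasurableSpace.comap X inferInstance] := by
    filter_upwards [hps, condExp_sub (integrable_const (1 : ℝ)) hA_int
      (MeasurableSpace.comap X inferInstance)] with ω h₁ h₂
    rw [h₁]
    refine Eq.trans ?_ h₂.symm
    rw [Pi.sub_apply, condExp_const hX.comap_le]
  obtain ⟨hint₁, heq₁⟩ := (hXY.comp measurable_id measurable_snd).integral_inv_mul_mul (c := 1)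
    hA hY1m hY1 (fun ω ↦ by rcases hA01 ω with h | h <;> simp [h]) hbX hps hε.1
    fun ω ↦ (hpos _).1
  obtain ⟨hint₀, heq₀⟩ := (hXY.comp (φ := fun a ↦ 1 - a) (measurable_id.const_sub 1)
    measurable_fst).integral_inv_mul_mul (c := 1) (hA.const_sub 1) hY0m hY0
    (fun ω ↦ by rcases hA01 ω with h | h <;> simp [h]) (hbX.const_sub 1) hps' hε.1
    fun ω ↦ by linarith [(hpos (X ω)).2]
  calc ∫ ω, (Y1 ω - Y0 ω) ∂μ
    _ = ∫ ω, ((b₁ (X ω))⁻¹ * (A ω * Y1 ω) - (1 - b₁ (X ω))⁻¹ * ((1 - A ω) * Y0 ω)) ∂μ := by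
      rw [integral_sub hY1 hY0]
      exact (congrArg₂ (· - ·) heq₁ heq₀).symm.trans (integral_sub hint₁ hint₀).symm
    _ = _ := by
      refine integral_congr_ae ?_
      filter_upwards [hcons] with ω hω
      rcases hA01 ω with h | h <;> simp [hω, h, div_eq_inv_mul]
end

section
/- Change-of-measure identity for inverse propensity weighting: let b₁ be a propensity score satisfying positivity with margin ε ∈ (0, 1/2). If m₁ : 𝒳 → ℝ is measurable with m₁(X) integrable and b₁(X)·m₁(X) a version of the conditional expectation E[A·Y | σ(X)] (so that m₁(x) represents E(Y | A = 1, X = x)), then E[A·Y/b₁(X)] = E[m₁(X)]. Likewise, if m₀' : 𝒳 → ℝ is measurable with m₀'(X) integrable and (1 − b₁(X))·m₀'(X) a version of E[(1−A)·Y | σ(X)], then E[(1−A)·Y/(1 − b₁(X))] = E[m₀'(X)]. -/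
open MeasureTheory ProbabilityTheory

/-- If `w * g` is a version of `E[Z | m]` for an `m`-measurable weight `w` bounded below by a
positive constant, then `E[Z / w] = E[g]`. -/
theorem integral_div_eq_of_mul_ae_eq_condExp {Ω : Type*} {m m₀ : MeasurableSpace Ω}
    (hm : m ≤ m₀) {μ : Measure Ω} [IsFiniteMeasure μ] {Z w g : Ω → ℝ} {ε : ℝ}
    (hZ : Integrable Z μ) (hw : Measurable[m] w) (hε : 0 < ε) (hεw : ∀ ω, ε ≤ w ω)
    (h : (fun ω => w ω * g ω) =ᵐ[μ] μ[Z | m]) :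
    ∫ ω, Z ω / w ω ∂μ = ∫ ω, g ω ∂μ := by
  have hw_pos : ∀ ω, 0 < w ω := fun ω => hε.trans_le (hεw ω)
  have hw_inv : StronglyMeasurable[m] w⁻¹ := hw.inv.stronglyMeasurable
  have hint : Integrable (Z * w⁻¹) μ := by
    refine hZ.mul_bdd (c := ε⁻¹) (hw_inv.mono hm).aestronglyMeasurable (.of_forall fun ω => ?_)
    rw [Pi.inv_apply, norm_inv, Real.norm_of_nonneg (hw_pos ω).le]
    exact inv_anti₀ hε (hεw ω)
  calc ∫ ω, Z ω / w ω ∂μ = ∫ ω, (Z * w⁻¹) ω ∂μ := by simp [div_eq_mul_inv]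
    _ = ∫ ω, (μ[Z * w⁻¹ | m]) ω ∂μ := (integral_condExp hm).symm
    _ = ∫ ω, g ω ∂μ := by
      refine integral_congr_ae ?_
      filter_upwards [condExp_mul_of_stronglyMeasurable_right hw_inv hint hZ, h] with ω h₁ h₂
      rw [h₁, Pi.mul_apply, ← h₂, Pi.inv_apply]
      have := (hw_pos ω).ne'
      field_simp

/-- **Change-of-measure identity for inverse propensity weighting.** If `b₁` is a propensity
score with positivity margin `ε ∈ (0, 1/2)`, then for any measurable `m₁` with `m₁(X)` integrable
and `b₁(X)·m₁(X)` a version of `E[A·Y | σ(X)]`, one has `E[A·Y/b₁(X)] = E[m₁(X)]`; and for any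
measurable `m₀'` with `m₀'(X)` integrable and `(1 − b₁(X))·m₀'(X)` a version of
`E[(1−A)·Y | σ(X)]`, one has `E[(1−A)·Y/(1 − b₁(X))] = E[m₀'(X)]`. -/
theorem ipw_change_of_measure
    {Ω 𝒳 : Type*} [MeasurableSpace Ω] [MeasurableSpace 𝒳]
    (μ : Measure Ω) [IsProbabilityMeasure μ]
    (X : Ω → 𝒳) (hX : Measurable X)
    (A : Ω → ℝ) (hA : Measurable A) (hA01 : ∀ ω, A ω = 0 ∨ A ω = 1)
    (Y : Ω → ℝ) (hY : Integrable Y μ)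
    (b₁ : 𝒳 → ℝ) (hb₁ : Measurable b₁)
    (hps : (fun ω => b₁ (X ω)) =ᵐ[μ] μ[A | MeasurableSpace.comap X inferInstance])
    (ε : ℝ) (hε : ε ∈ Set.Ioo (0 : ℝ) (1/2))
    (hpos : ∀ x, ε ≤ b₁ x ∧ b₁ x ≤ 1 - ε) :
    (∀ m₁ : 𝒳 → ℝ, Measurable m₁ → Integrable (fun ω => m₁ (X ω)) μ →
      ((fun ω => b₁ (X ω) * m₁ (X ω)) =ᵐ[μ]
        μ[(fun ω => A ω * Y ω) | MeasurableSpace.comap X inferInstance]) →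
      ∫ ω, A ω * Y ω / b₁ (X ω) ∂μ = ∫ ω, m₁ (X ω) ∂μ) ∧
    (∀ m₀' : 𝒳 → ℝ, Measurable m₀' → Integrable (fun ω => m₀' (X ω)) μ →
      ((fun ω => (1 - b₁ (X ω)) * m₀' (X ω)) =ᵐ[μ]
        μ[(fun ω => (1 - A ω) * Y ω) | MeasurableSpace.comap X inferInstance]) →
      ∫ ω, (1 - A ω) * Y ω / (1 - b₁ (X ω)) ∂μ = ∫ ω, m₀' (X ω) ∂μ) := by
  have hb : Measurable[MeasurableSpace.comap X inferInstance] fun ω => b₁ (X ω) :=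
    hb₁.comp (comap_measurable X)
  have hAY : Integrable (fun ω => A ω * Y ω) μ :=
    hY.bdd_mul (c := 1) hA.aestronglyMeasurable
      (.of_forall fun ω => by rcases hA01 ω with h | h <;> simp [h])
  have hAY' : Integrable (fun ω => (1 - A ω) * Y ω) μ := by
    simp only [sub_mul, one_mul]
    exact hY.sub hAY
  exact ⟨fun m₁ _ _ h => integral_div_eq_of_mul_ae_eq_condExp hX.comap_le hAY hb hε.1
      (fun ω => (hpos (X ω)).1) h,
    fun m₀' _ _ h => integral_div_eq_of_mul_ae_eq_condExp hX.comap_le hAY' (hb.const_sub 1) hε.1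
      (fun ω => by linarith [(hpos (X ω)).2]) h⟩
end

section
/- Double robustness of the AIPW score with respect to the outcome model: let b₁ be a propensity score satisfying positivity with margin ε ∈ (0, 1/2) and let m̃ : {0,1} × 𝒳 → ℝ be any bounded measurable function. Then E[ψ(m̃, b₁)] = E[A·Y/b₁(X) − (1−A)·Y/(1 − b₁(X))]; in particular, the mean of the AIPW score computed with the true propensity score does not depend on the choice of the outcome model m̃. -/
open MeasureTheory ProbabilityTheory

/-- The AIPW (doubly robust) score `ψ(m, b)` built from covariates `X`, (real-valued `{0,1}`)
treatment `A`, outcome `Y`, outcome model `m` and propensity model `b`. -/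
noncomputable def aipwScore {Ω 𝒳 : Type*} (X : Ω → 𝒳) (A Y : Ω → ℝ)
    (m : ℝ → 𝒳 → ℝ) (b : 𝒳 → ℝ) (ω : Ω) : ℝ :=
  m 1 (X ω) - m 0 (X ω) + A ω * (Y ω - m (A ω) (X ω)) / b (X ω)
    - (1 - A ω) * (Y ω - m (A ω) (X ω)) / (1 - b (X ω))

/-- A bounded measurable function of `X` is orthogonal to the residual `b ∘ X - A`, where `b ∘ X`
is a version of the conditional expectation of `A` given `X`. -/
theorem integral_comp_mul_sub_eq_zero_of_ae_eq_condExp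
    {Ω 𝒳 : Type*} [MeasurableSpace Ω] [m𝒳 : MeasurableSpace 𝒳]
    {μ : Measure Ω} [IsFiniteMeasure μ] {X : Ω → 𝒳} (hX : Measurable X)
    {A : Ω → ℝ} (hA : Integrable A μ) {b g : 𝒳 → ℝ}
    (hb : (fun ω => b (X ω)) =ᵐ[μ] μ[A | MeasurableSpace.comap X m𝒳])
    (hg : Measurable g) {C : ℝ} (hC : ∀ x, |g x| ≤ C) :
    Integrable (fun ω => g (X ω) * (b (X ω) - A ω)) μ ∧
      ∫ ω, g (X ω) * (b (X ω) - A ω) ∂μ = 0 := by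
  have hm := hX.comap_le
  have hbi : Integrable (fun ω => b (X ω)) μ := integrable_condExp.congr hb.symm
  have hgm : AEStronglyMeasurable (fun ω => g (X ω)) μ := (hg.comp hX).aestronglyMeasurable
  have hgC : ∀ᵐ ω ∂μ, ‖g (X ω)‖ ≤ C := .of_forall fun ω => hC (X ω)
  have hgA : Integrable (fun ω => g (X ω) * A ω) μ := hA.bdd_mul hgm hgC
  have hgb : Integrable (fun ω => g (X ω) * b (X ω)) μ := hbi.bdd_mul hgm hgC
  refine ⟨(hbi.sub hA).bdd_mul hgm hgC, ?_⟩
  have hpull := condExp_mul_of_stronglyMeasurable_left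
    (m := MeasurableSpace.comap X m𝒳) (f := fun ω => g (X ω))
    (hg.comp (comap_measurable X)).stronglyMeasurable hgA hA
  have heq : ∫ ω, g (X ω) * b (X ω) ∂μ = ∫ ω, g (X ω) * A ω ∂μ := by
    rw [← integral_condExp hm (f := fun ω => g (X ω) * A ω)]
    refine integral_congr_ae ?_
    filter_upwards [hb, hpull] with ω h₁ h₂
    rw [h₁]
    exact h₂.symm
  simp_rw [mul_sub]
  rw [integral_sub hgb hgA, heq, sub_self]

/-- For a binary treatment, the AIPW score is the inverse-probability-weighted score plus a function
of the covariates times the treatment residual. -/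
theorem aipwScore_eq_add_mul_sub {Ω 𝒳 : Type*} {X : Ω → 𝒳} {A Y : Ω → ℝ}
    {m : ℝ → 𝒳 → ℝ} {b : 𝒳 → ℝ} {ω : Ω} (hA : A ω = 0 ∨ A ω = 1)
    (hb : b (X ω) ≠ 0) (hb' : 1 - b (X ω) ≠ 0) :
    aipwScore X A Y m b ω =
      (A ω * Y ω / b (X ω) - (1 - A ω) * Y ω / (1 - b (X ω))) +
        (m 1 (X ω) / b (X ω) + m 0 (X ω) / (1 - b (X ω))) * (b (X ω) - A ω) := by
  unfold aipwScore
  rcases hA with h | h <;> rw [h] <;> field_simp <;> ring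

/-- Dividing by a quantity bounded below by `ε > 0` costs a factor at most `1 / ε`. -/
theorem abs_div_le_div_of_le {a b C ε : ℝ} (hε : 0 < ε) (ha : |a| ≤ C) (hb : ε ≤ b) :
    |a / b| ≤ C / ε := by
  rw [abs_div, abs_of_pos (hε.trans_le hb)]
  exact div_le_div₀ ((abs_nonneg a).trans ha) ha hε hb

/-- **Double robustness of the AIPW score w.r.t. the outcome model.** With the true propensity
score `b₁` (satisfying positivity with margin `ε ∈ (0,1/2)`) and any bounded measurable outcome
model `mTil`, the mean of the AIPW score equals `E[A·Y/b₁(X) − (1−A)·Y/(1 − b₁(X))]`; in particular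
it does not depend on `mTil`. -/
theorem aipw_double_robust_outcome_model
    {Ω 𝒳 : Type*} [MeasurableSpace Ω] [MeasurableSpace 𝒳]
    (μ : Measure Ω) [IsProbabilityMeasure μ]
    (X : Ω → 𝒳) (hX : Measurable X)
    (A : Ω → ℝ) (hA : Measurable A) (hA01 : ∀ ω, A ω = 0 ∨ A ω = 1)
    (Y : Ω → ℝ) (hY : Integrable Y μ)
    (b₁ : 𝒳 → ℝ) (hb₁ : Measurable b₁)
    (hps : (fun ω => b₁ (X ω)) =ᵐ[μ] μ[A | MeasurableSpace.comap X inferInstance])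
    (ε : ℝ) (hε : ε ∈ Set.Ioo (0 : ℝ) (1/2))
    (hpos : ∀ x, ε ≤ b₁ x ∧ b₁ x ≤ 1 - ε)
    (mTil : ℝ → 𝒳 → ℝ) (hmTil : Measurable (fun p : ℝ × 𝒳 => mTil p.1 p.2))
    (hmTilbdd : ∃ C, ∀ a x, |mTil a x| ≤ C) :
    ∫ ω, aipwScore X A Y mTil b₁ ω ∂μ =
      ∫ ω, (A ω * Y ω / b₁ (X ω) - (1 - A ω) * Y ω / (1 - b₁ (X ω))) ∂μ := by
  obtain ⟨C, hC⟩ := hmTilbdd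
  have hε₀ : 0 < ε := hε.1
  have hpos' : ∀ x, ε ≤ 1 - b₁ x := fun x => by linarith [(hpos x).2]
  have hAle : ∀ ω, |A ω| ≤ 1 := fun ω => by rcases hA01 ω with h | h <;> simp [h]
  have hAle' : ∀ ω, |1 - A ω| ≤ 1 := fun ω => by rcases hA01 ω with h | h <;> simp [h]
  have hAi : Integrable A μ := .of_bound hA.aestronglyMeasurable 1 (.of_forall hAle)
  have hm (a : ℝ) : Measurable (mTil a) := hmTil.comp measurable_prodMk_left
  have hbX : Measurable fun ω => b₁ (X ω) := hb₁.comp hX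
  obtain ⟨hi, hzero⟩ := integral_comp_mul_sub_eq_zero_of_ae_eq_condExp hX hAi hps
    (g := fun x => mTil 1 x / b₁ x + mTil 0 x / (1 - b₁ x)) (C := C / ε + C / ε)
    (((hm 1).div hb₁).add ((hm 0).div (hb₁.const_sub 1)))
    (fun x => (abs_add_le _ _).trans (add_le_add
      (abs_div_le_div_of_le hε₀ (hC 1 x) (hpos x).1)
      (abs_div_le_div_of_le hε₀ (hC 0 x) (hpos' x))))
  have h₁ : Integrable (fun ω => A ω * Y ω / b₁ (X ω)) μ := by
    simp_rw [mul_div_right_comm]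
    exact hY.bdd_mul (hA.div hbX).aestronglyMeasurable
      (.of_forall fun ω => abs_div_le_div_of_le hε₀ (hAle ω) (hpos (X ω)).1)
  have h₀ : Integrable (fun ω => (1 - A ω) * Y ω / (1 - b₁ (X ω))) μ := by
    simp_rw [mul_div_right_comm]
    exact hY.bdd_mul ((hA.const_sub 1).div (hbX.const_sub 1)).aestronglyMeasurable
      (.of_forall fun ω => abs_div_le_div_of_le hε₀ (hAle' ω) (hpos' (X ω)))
  have hscore (ω : Ω) := aipwScore_eq_add_mul_sub (Y := Y) (m := mTil) (hA01 ω)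
    (hε₀.trans_le (hpos (X ω)).1).ne' (hε₀.trans_le (hpos' (X ω))).ne'
  simp_rw [hscore]
  refine (integral_add (h₁.sub h₀) hi).trans ?_
  rw [hzero, add_zero]
  rfl
end

section
/- Double robustness of the AIPW score with respect to the propensity model: let m₀ be an outcome regression with m₀(1, X) and m₀(0, X) integrable, and let b̃ : 𝒳 → ℝ be any measurable function with ε ≤ b̃(x) ≤ 1 − ε for all x, for some ε ∈ (0, 1/2). Then E[ψ(m₀, b̃)] = E[m₀(1, X) − m₀(0, X)]; in particular, the mean of the AIPW score computed with the true outcome regression does not depend on the choice of b̃. -/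
open MeasureTheory ProbabilityTheory

/-- The residual of a conditional expectation is orthogonal to every bounded function that is
measurable with respect to the conditioning σ-algebra. -/
theorem integral_mul_sub_condExp_eq_zero {Ω : Type*} {m mΩ : MeasurableSpace Ω} {μ : Measure Ω}
    [IsFiniteMeasure μ] (hm : m ≤ mΩ) {w Y : Ω → ℝ} (hw : StronglyMeasurable[m] w) {C : ℝ}
    (hwC : ∀ ω, ‖w ω‖ ≤ C) (hY : Integrable Y μ) :
    ∫ ω, w ω * (Y ω - (μ[Y | m]) ω) ∂μ = 0 := by
  have hR : Integrable (Y - μ[Y | m]) μ := hY.sub integrable_condExp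
  have hwR : Integrable (w * (Y - μ[Y | m])) μ :=
    hR.bdd_mul (hw.mono hm).aestronglyMeasurable (.of_forall hwC)
  have hzero : μ[Y - μ[Y | m] | m] =ᵐ[μ] 0 := by
    have hself : μ[μ[Y | m] | m] = μ[Y | m] :=
      condExp_of_stronglyMeasurable hm stronglyMeasurable_condExp integrable_condExp
    filter_upwards [condExp_sub hY integrable_condExp m] with ω h
    rw [h, hself, Pi.sub_apply, sub_self, Pi.zero_apply]
  calc ∫ ω, w ω * (Y ω - (μ[Y | m]) ω) ∂μ
      = ∫ ω, (μ[w * (Y - μ[Y | m]) | m]) ω ∂μ := (integral_condExp hm).symm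
    _ = ∫ _, (0 : ℝ) ∂μ := by
        refine integral_congr_ae ?_
        filter_upwards [condExp_mul_of_stronglyMeasurable_left hw hwR hR, hzero] with ω h h₀
        rw [h, Pi.mul_apply, h₀, Pi.zero_apply, mul_zero]
    _ = 0 := integral_zero _ _

/-- **Double robustness of the AIPW score w.r.t. the propensity model.** With the true outcome
regression `m₀` (a version of `E[Y | σ(A, X)]`, with `m₀(1,X)` and `m₀(0,X)` integrable) and any
measurable propensity model `b̃` bounded in `[ε, 1−ε]`, the mean of the AIPW score equals
`E[m₀(1,X) − m₀(0,X)]`; in particular it does not depend on `b̃`. -/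
theorem aipw_double_robust_propensity_model
    {Ω 𝒳 : Type*} [MeasurableSpace Ω] [MeasurableSpace 𝒳]
    (μ : Measure Ω) [IsProbabilityMeasure μ]
    (X : Ω → 𝒳) (hX : Measurable X)
    (A : Ω → ℝ) (hA : Measurable A) (hA01 : ∀ ω, A ω = 0 ∨ A ω = 1)
    (Y : Ω → ℝ) (hY : Integrable Y μ)
    (m₀ : ℝ → 𝒳 → ℝ) (hm₀ : Measurable (fun p : ℝ × 𝒳 => m₀ p.1 p.2))
    -- `m₀` is the outcome regression: a version of `E[Y | σ(A, X)]`
    (hreg : (fun ω => m₀ (A ω) (X ω)) =ᵐ[μ]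
      μ[Y | MeasurableSpace.comap (fun ω => (A ω, X ω)) inferInstance])
    (hint1 : Integrable (fun ω => m₀ 1 (X ω)) μ)
    (hint0 : Integrable (fun ω => m₀ 0 (X ω)) μ)
    (bTil : 𝒳 → ℝ) (hbTil : Measurable bTil)
    (ε : ℝ) (hε : ε ∈ Set.Ioo (0 : ℝ) (1/2))
    (hbound : ∀ x, ε ≤ bTil x ∧ bTil x ≤ 1 - ε) :
    ∫ ω, aipwScore X A Y m₀ bTil ω ∂μ = ∫ ω, (m₀ 1 (X ω) - m₀ 0 (X ω)) ∂μ := by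
  set w : Ω → ℝ := fun ω => A ω / bTil (X ω) - (1 - A ω) / (1 - bTil (X ω)) with hw_def
  have hw : StronglyMeasurable[MeasurableSpace.comap (fun ω => (A ω, X ω)) inferInstance] w := by
    have hg : Measurable fun p : ℝ × 𝒳 => p.1 / bTil p.2 - (1 - p.1) / (1 - bTil p.2) := by
      fun_prop
    exact (hg.comp (comap_measurable _)).stronglyMeasurable
  have hwC (ω : Ω) : ‖w ω‖ ≤ ε⁻¹ := by
    obtain ⟨hl, hu⟩ := hbound (X ω)
    have hε0 := hε.1
    rcases hA01 ω with h | h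
    · have hpos : 0 < 1 - bTil (X ω) := by linarith
      simp only [hw_def, h, zero_div, sub_zero, zero_sub, one_div, norm_neg, norm_inv,
        Real.norm_of_nonneg hpos.le]
      exact inv_anti₀ hε0 (by linarith)
    · have hpos : 0 < bTil (X ω) := by linarith
      simp only [hw_def, h, sub_self, zero_div, sub_zero, one_div, norm_inv,
        Real.norm_of_nonneg hpos.le]
      exact inv_anti₀ hε0 hl
  have hscore : aipwScore X A Y m₀ bTil =
      fun ω => (m₀ 1 (X ω) - m₀ 0 (X ω)) + w ω * (Y ω - m₀ (A ω) (X ω)) := by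
    ext ω
    simp only [aipwScore, hw_def]
    ring
  have hm := (hA.prodMk hX).comap_le
  have hwR : Integrable (fun ω => w ω * (Y ω - m₀ (A ω) (X ω))) μ :=
    (hY.sub (integrable_condExp.congr hreg.symm)).bdd_mul
      (hw.mono hm).aestronglyMeasurable (.of_forall hwC)
  have hzero : ∫ ω, w ω * (Y ω - m₀ (A ω) (X ω)) ∂μ = 0 := by
    rw [← integral_mul_sub_condExp_eq_zero hm hw hwC hY]
    refine integral_congr_ae ?_
    filter_upwards [hreg] with ω h
    rw [h]
  have hdiff : Integrable (fun ω => m₀ 1 (X ω) - m₀ 0 (X ω)) μ := hint1.sub hint0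
  rw [hscore, integral_add hdiff hwR, hzero, add_zero]
end

section
/- The doubly robust pseudo-outcome is unbiased for the ATE if either nuisance function is correctly specified: assume consistency (Y = A·Y¹ + (1−A)·Y⁰ a.s.), unconfoundedness (σ(A) conditionally independent of σ(Y⁰, Y¹) given σ(X)), and a propensity score b₁ with positivity margin ε ∈ (0, 1/2), and let m₀ be an outcome regression with m₀(1,X), m₀(0,X) integrable. Then both of the following hold: (i) for every bounded measurable m̃ : {0,1} × 𝒳 → ℝ, E[ψ(m̃, b₁)] = E[Y¹ − Y⁰]; and (ii) for every measurable b̃ : 𝒳 → ℝ with ε ≤ b̃ ≤ 1 − ε, E[ψ(m₀, b̃)] = E[Y¹ − Y⁰]. -/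
open MeasureTheory ProbabilityTheory

section InverseProbabilityWeighting

variable {Ω : Type*} {m mΩ : MeasurableSpace Ω} {μ : Measure Ω}

theorem integrable_mul_div {T Z e : Ω → ℝ} {C ε : ℝ} (hT : Measurable T)
    (hTb : ∀ ω, |T ω| ≤ C) (hZ : Integrable Z μ) (he : Measurable e) (hε : 0 < ε)
    (heε : ∀ ω, ε ≤ e ω) : Integrable (fun ω => T ω * Z ω / e ω) μ := by
  have h := hZ.bdd_mul (c := C / ε) (hT.div he).aestronglyMeasurable
    (.of_forall fun ω => by
      have := hε.trans_le (heε ω)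
      have hC := (abs_nonneg _).trans (hTb ω)
      rw [Pi.div_apply, Real.norm_eq_abs, abs_div, abs_of_pos this]
      exact div_le_div₀ hC (hTb ω) hε (heε ω))
  refine h.congr (.of_forall fun ω => ?_)
  simp only [Pi.div_apply]
  ring

variable [IsProbabilityMeasure μ]

theorem integral_mul_condExp (hm : m ≤ mΩ) {f g : Ω → ℝ} (hg : StronglyMeasurable[m] g)
    (hgf : Integrable (g * f) μ) (hf : Integrable f μ) :
    ∫ ω, g ω * (μ[f | m]) ω ∂μ = ∫ ω, g ω * f ω ∂μ := by
  have h := integral_condExp (μ := μ) (f := g * f) hm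
  rw [integral_congr_ae (condExp_mul_of_stronglyMeasurable_left hg hgf hf)] at h
  exact h

/-- Weighting the residual of a conditional expectation has mean zero. -/
theorem integral_mul_sub_condExp_div_eq_zero (hm : m ≤ mΩ) {T Y M e : Ω → ℝ} {C ε : ℝ}
    (hT : Measurable[m] T) (hTb : ∀ ω, |T ω| ≤ C) (hY : Integrable Y μ)
    (hM : M =ᵐ[μ] μ[Y | m]) (he : Measurable[m] e) (hε : 0 < ε) (heε : ∀ ω, ε ≤ e ω) :
    ∫ ω, T ω * (Y ω - M ω) / e ω ∂μ = 0 := by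
  have hT' := hT.mono hm le_rfl
  have he' := he.mono hm le_rfl
  have hYi := integrable_mul_div hT' hTb hY he' hε heε
  have hMi := integrable_mul_div hT' hTb (integrable_condExp.congr hM.symm) he' hε heε
  have hgf : Integrable ((T / e) * Y) μ := hYi.congr (.of_forall fun ω => by
    simp only [Pi.mul_apply, Pi.div_apply]; ring)
  have h := integral_mul_condExp hm (hT.div he).stronglyMeasurable hgf hY
  calc ∫ ω, T ω * (Y ω - M ω) / e ω ∂μ
      = ∫ ω, T ω * Y ω / e ω ∂μ - ∫ ω, T ω * M ω / e ω ∂μ := by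
        rw [← integral_sub hYi hMi]
        congr with ω
        ring
    _ = ∫ ω, (T / e) ω * Y ω ∂μ - ∫ ω, (T / e) ω * (μ[Y | m]) ω ∂μ := by
        congr 1
        · congr with ω
          simp only [Pi.div_apply]; ring
        · refine integral_congr_ae ?_
          filter_upwards [hM] with ω hω
          simp only [Pi.div_apply, hω]; ring
    _ = 0 := by rw [h, sub_self]

variable [StandardBorelSpace Ω]

theorem ProbabilityTheory.CondIndepFun.condExp_mul_s4 {hm : m ≤ mΩ} {T Z : Ω → ℝ}
    (hTZ : CondIndepFun m hm T Z μ) (hTm : Measurable T) (hZm : Measurable Z)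
    (hT : Integrable T μ) (hZ : Integrable Z μ) (hTZi : Integrable (T * Z) μ) :
    μ[T * Z | m] =ᵐ[μ] μ[T | m] * μ[Z | m] := by
  have h := ae_of_ae_trim hm ((condIndepFun_iff_map_prod_eq_prod_map_map hTm hZm).1 hTZ)
  filter_upwards [h, condExp_ae_eq_integral_condExpKernel hm hTZi,
    condExp_ae_eq_integral_condExpKernel hm hT,
    condExp_ae_eq_integral_condExpKernel hm hZ] with ω hω h₁ h₂ h₃
  rw [Kernel.prod_apply, Kernel.map_apply _ (hTm.prodMk hZm), Kernel.map_apply _ hTm,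
    Kernel.map_apply _ hZm,
    ← indepFun_iff_map_prod_eq_prod_map_map hTm.aemeasurable hZm.aemeasurable] at hω
  rw [Pi.mul_apply, h₁, h₂, h₃]
  exact hω.integral_mul_eq_mul_integral hTm.aestronglyMeasurable hZm.aestronglyMeasurable

/-- Inverse probability weighting recovers the mean of a variable that is conditionally
independent of the treatment. -/
theorem ProbabilityTheory.CondIndepFun.integral_mul_div_eq {hm : m ≤ mΩ} {T Z e : Ω → ℝ}
    {C ε : ℝ} (hTZ : CondIndepFun m hm T Z μ) (hT : Measurable T) (hTb : ∀ ω, |T ω| ≤ C)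
    (hZm : Measurable Z) (hZ : Integrable Z μ) (he : Measurable[m] e) (hε : 0 < ε)
    (heε : ∀ ω, ε ≤ e ω) (heT : e =ᵐ[μ] μ[T | m]) :
    ∫ ω, T ω * Z ω / e ω ∂μ = ∫ ω, Z ω ∂μ := by
  have hTi : Integrable T μ := .of_bound hT.aestronglyMeasurable C (.of_forall hTb)
  have hTZi : Integrable (T * Z) μ := hZ.bdd_mul hT.aestronglyMeasurable (.of_forall hTb)
  have hgf : Integrable (e⁻¹ * (T * Z)) μ :=
    (integrable_mul_div hT hTb hZ (he.mono hm le_rfl) hε heε).congr (.of_forall fun ω => by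
      simp only [Pi.mul_apply, Pi.inv_apply]; ring)
  calc ∫ ω, T ω * Z ω / e ω ∂μ
      = ∫ ω, e⁻¹ ω * (T * Z) ω ∂μ := by
        congr with ω
        simp only [Pi.mul_apply, Pi.inv_apply]; ring
    _ = ∫ ω, e⁻¹ ω * (μ[T * Z | m]) ω ∂μ :=
        (integral_mul_condExp hm he.inv.stronglyMeasurable hgf hTZi).symm
    _ = ∫ ω, (μ[Z | m]) ω ∂μ := by
        refine integral_congr_ae ?_
        filter_upwards [hTZ.condExp_mul_s4 hT hZm hTi hZ hTZi, heT] with ω h₁ h₂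
        have := (hε.trans_le (heε ω)).ne'
        rw [h₁, Pi.mul_apply, ← h₂, Pi.inv_apply]
        field_simp
    _ = ∫ ω, Z ω ∂μ := integral_condExp hm

/-- The augmentation term of one treatment arm corrects the mean of the outcome model `h`,
provided the propensity score is correct. -/
theorem ProbabilityTheory.CondIndepFun.integral_mul_sub_div_eq {hm : m ≤ mΩ} {T Z R h e : Ω → ℝ}
    {C ε : ℝ} (hTZ : CondIndepFun m hm T Z μ) (hT : Measurable T) (hTb : ∀ ω, |T ω| ≤ C)
    (hZm : Measurable Z) (hZ : Integrable Z μ) (hhm : Measurable[m] h) (hh : Integrable h μ)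
    (hR : ∀ᵐ ω ∂μ, T ω * R ω = T ω * (Z ω - h ω)) (he : Measurable[m] e) (hε : 0 < ε)
    (heε : ∀ ω, ε ≤ e ω) (heT : e =ᵐ[μ] μ[T | m]) :
    ∫ ω, T ω * R ω / e ω ∂μ = ∫ ω, Z ω ∂μ - ∫ ω, h ω ∂μ := by
  have hTh : CondIndepFun m hm T h μ := condIndepFun_of_measurable_right hT hhm
  have he' := he.mono hm le_rfl
  rw [← hTZ.integral_mul_div_eq hT hTb hZm hZ he hε heε heT,
    ← hTh.integral_mul_div_eq hT hTb (hhm.mono hm le_rfl) hh he hε heε heT,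
    ← integral_sub (integrable_mul_div hT hTb hZ he' hε heε)
      (integrable_mul_div hT hTb hh he' hε heε)]
  refine integral_congr_ae ?_
  filter_upwards [hR] with ω hω
  rw [hω]
  ring

end InverseProbabilityWeighting

/-- **Unbiasedness of the doubly robust pseudo-outcome for the ATE when either nuisance is
correct.** Under consistency, unconfoundedness and positivity: (i) for every bounded measurable
outcome model `m̃`, `E[ψ(m̃, b₁)] = E[Y¹ − Y⁰]`; and (ii) for every measurable propensity model
`b̃` with `ε ≤ b̃ ≤ 1 − ε`, `E[ψ(m₀, b̃)] = E[Y¹ − Y⁰]`. -/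
theorem aipw_unbiased_if_either_nuisance_correct
    {Ω 𝒳 : Type*} [MeasurableSpace Ω] [StandardBorelSpace Ω] [MeasurableSpace 𝒳]
    (μ : Measure Ω) [IsProbabilityMeasure μ]
    (X : Ω → 𝒳) (hX : Measurable X)
    (A : Ω → ℝ) (hA : Measurable A) (hA01 : ∀ ω, A ω = 0 ∨ A ω = 1)
    (Y Y0 Y1 : Ω → ℝ)
    (hY : Integrable Y μ) (hY0 : Integrable Y0 μ) (hY1 : Integrable Y1 μ)
    (hY0m : Measurable Y0) (hY1m : Measurable Y1)
    (b₁ : 𝒳 → ℝ) (hb₁ : Measurable b₁)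
    (hps : (fun ω => b₁ (X ω)) =ᵐ[μ] μ[A | MeasurableSpace.comap X inferInstance])
    (ε : ℝ) (hε : ε ∈ Set.Ioo (0 : ℝ) (1/2))
    (hpos : ∀ x, ε ≤ b₁ x ∧ b₁ x ≤ 1 - ε)
    (hcons : ∀ᵐ ω ∂μ, Y ω = A ω * Y1 ω + (1 - A ω) * Y0 ω)
    (hunconf : CondIndep (MeasurableSpace.comap X inferInstance)
      (MeasurableSpace.comap A inferInstance)
      (MeasurableSpace.comap (fun ω => (Y0 ω, Y1 ω)) inferInstance)
      hX.comap_le μ)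
    (m₀ : ℝ → 𝒳 → ℝ) (hm₀ : Measurable (fun p : ℝ × 𝒳 => m₀ p.1 p.2))
    (hreg : (fun ω => m₀ (A ω) (X ω)) =ᵐ[μ]
      μ[Y | MeasurableSpace.comap (fun ω => (A ω, X ω)) inferInstance])
    (hint1 : Integrable (fun ω => m₀ 1 (X ω)) μ)
    (hint0 : Integrable (fun ω => m₀ 0 (X ω)) μ) :
    (∀ mTil : ℝ → 𝒳 → ℝ, Measurable (fun p : ℝ × 𝒳 => mTil p.1 p.2) →
      (∃ C, ∀ a x, |mTil a x| ≤ C) →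
      ∫ ω, aipwScore X A Y mTil b₁ ω ∂μ = ∫ ω, (Y1 ω - Y0 ω) ∂μ) ∧
    (∀ bTil : 𝒳 → ℝ, Measurable bTil → (∀ x, ε ≤ bTil x ∧ bTil x ≤ 1 - ε) →
      ∫ ω, aipwScore X A Y m₀ bTil ω ∂μ = ∫ ω, (Y1 ω - Y0 ω) ∂μ) := by
  have hmAX : MeasurableSpace.comap (fun ω => (A ω, X ω)) inferInstance
      ≤ (inferInstance : MeasurableSpace Ω) := (hA.prodMk hX).comap_le
  have hXm : Measurable[MeasurableSpace.comap X inferInstance] X := comap_measurable X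
  have hAXm : Measurable[MeasurableSpace.comap (fun ω => (A ω, X ω)) inferInstance]
      (fun ω => (A ω, X ω)) := comap_measurable _
  have hB : Measurable (fun ω => 1 - A ω) := measurable_const.sub hA
  have hAb : ∀ ω, |A ω| ≤ 1 := fun ω => by rcases hA01 ω with h | h <;> simp [h]
  have hBb : ∀ ω, |1 - A ω| ≤ 1 := fun ω => by rcases hA01 ω with h | h <;> simp [h]
  have hAi : Integrable A μ := .of_bound hA.aestronglyMeasurable 1 (.of_forall hAb)
  have hind : CondIndepFun _ hX.comap_le A (fun ω => (Y0 ω, Y1 ω)) μ :=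
    (condIndepFun_iff_condIndep _ hX.comap_le _ _ μ).2 hunconf
  have hind1 : CondIndepFun _ hX.comap_le A Y1 μ := hind.comp measurable_id measurable_snd
  have hind0 : CondIndepFun _ hX.comap_le (fun ω => 1 - A ω) Y0 μ :=
    hind.comp (measurable_const.sub measurable_id) measurable_fst
  have hps0 : (fun ω => 1 - b₁ (X ω)) =ᵐ[μ]
      μ[fun ω => 1 - A ω | MeasurableSpace.comap X inferInstance] := by
    filter_upwards [hps, condExp_sub (integrable_const (1 : ℝ)) hAi
      (MeasurableSpace.comap X inferInstance)] with ω h₁ h₂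
    rw [h₁]
    refine Eq.trans ?_ h₂.symm
    rw [Pi.sub_apply, condExp_const hX.comap_le]
  have harm (M : ℝ → 𝒳 → ℝ) (hM : Measurable (fun p : ℝ × 𝒳 => M p.1 p.2))
      (h1 : Integrable (fun ω => M 1 (X ω)) μ) (h0 : Integrable (fun ω => M 0 (X ω)) μ) :
      ∫ ω, A ω * (Y ω - M (A ω) (X ω)) / b₁ (X ω) ∂μ
          = ∫ ω, Y1 ω ∂μ - ∫ ω, M 1 (X ω) ∂μ ∧
        ∫ ω, (1 - A ω) * (Y ω - M (A ω) (X ω)) / (1 - b₁ (X ω)) ∂μ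
          = ∫ ω, Y0 ω ∂μ - ∫ ω, M 0 (X ω) ∂μ := by
    constructor
    · refine hind1.integral_mul_sub_div_eq hA hAb hY1m hY1
        ((hM.comp (measurable_const.prodMk measurable_id)).comp hXm) h1 ?_ (hb₁.comp hXm) hε.1
        (fun ω => (hpos _).1) hps
      filter_upwards [hcons] with ω hω
      rcases hA01 ω with h | h <;> simp [hω, h]
    · refine hind0.integral_mul_sub_div_eq hB hBb hY0m hY0
        ((hM.comp (measurable_const.prodMk measurable_id)).comp hXm) h0 ?_
        (measurable_const.sub (hb₁.comp hXm)) hε.1 (fun ω => by linarith [(hpos (X ω)).2]) hps0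
      filter_upwards [hcons] with ω hω
      rcases hA01 ω with h | h <;> simp [hω, h]
  have hscore (M : ℝ → 𝒳 → ℝ) (b : 𝒳 → ℝ) (hb : Measurable b)
      (hbε : ∀ x, ε ≤ b x ∧ b x ≤ 1 - ε) (h1 : Integrable (fun ω => M 1 (X ω)) μ)
      (h0 : Integrable (fun ω => M 0 (X ω)) μ)
      (hMA : Integrable (fun ω => M (A ω) (X ω)) μ) :
      ∫ ω, aipwScore X A Y M b ω ∂μ = ∫ ω, M 1 (X ω) ∂μ - ∫ ω, M 0 (X ω) ∂μ
        + ∫ ω, A ω * (Y ω - M (A ω) (X ω)) / b (X ω) ∂μ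
        - ∫ ω, (1 - A ω) * (Y ω - M (A ω) (X ω)) / (1 - b (X ω)) ∂μ := by
    have i1 : Integrable (fun ω => A ω * (Y ω - M (A ω) (X ω)) / b (X ω)) μ :=
      integrable_mul_div hA hAb (hY.sub hMA) (hb.comp hX) hε.1 fun ω => (hbε _).1
    have i0 : Integrable (fun ω => (1 - A ω) * (Y ω - M (A ω) (X ω)) / (1 - b (X ω))) μ :=
      integrable_mul_div hB hBb (hY.sub hMA) (measurable_const.sub (hb.comp hX)) hε.1
        fun ω => show ε ≤ 1 - b (X ω) by linarith [(hbε (X ω)).2]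
    have hd : Integrable (fun ω => M 1 (X ω) - M 0 (X ω)) μ := h1.sub h0
    rw [← integral_sub h1 h0, ← integral_add hd i1]
    exact integral_sub (hd.add i1) i0
  refine ⟨fun M hM ⟨C, hC⟩ => ?_, fun b hb hbε => ?_⟩
  · have hMi (f : Ω → ℝ) (hf : Measurable f) : Integrable (fun ω => M (f ω) (X ω)) μ :=
      .of_bound (hM.comp (hf.prodMk hX)).aestronglyMeasurable C (.of_forall fun ω => hC _ _)
    have h1 := hMi _ (measurable_const (a := 1))
    have h0 := hMi _ (measurable_const (a := 0))
    rw [hscore M b₁ hb₁ hpos h1 h0 (hMi A hA), (harm M hM h1 h0).1, (harm M hM h1 h0).2,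
      integral_sub hY1 hY0]
    ring
  · have hAm := measurable_fst.comp hAXm
    have hres (c : 𝒳 → ℝ) (hc : Measurable c) (hcε : ∀ x, ε ≤ c x ∧ c x ≤ 1 - ε) :
        ∫ ω, A ω * (Y ω - m₀ (A ω) (X ω)) / c (X ω) ∂μ = 0 ∧
          ∫ ω, (1 - A ω) * (Y ω - m₀ (A ω) (X ω)) / (1 - c (X ω)) ∂μ = 0 := by
      have hcm := hc.comp (measurable_snd.comp hAXm)
      exact ⟨integral_mul_sub_condExp_div_eq_zero hmAX hAm hAb hY hreg hcm hε.1
          (fun ω => (hcε _).1),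
        integral_mul_sub_condExp_div_eq_zero hmAX (measurable_const.sub hAm) hBb hY hreg
          (measurable_const.sub hcm) hε.1
          (fun ω => show ε ≤ 1 - c (X ω) by linarith [(hcε (X ω)).2])⟩
    rw [hscore m₀ b hb hbε hint1 hint0 (integrable_condExp.congr hreg.symm), (hres b hb hbε).1,
      (hres b hb hbε).2, integral_sub hY1 hY0]
    have h := harm m₀ hm₀ hint1 hint0
    rw [(hres b₁ hb₁ hpos).1, (hres b₁ hb₁ hpos).2] at h
    linarith [h.1, h.2]
end

section
/- The bandit density evaluated at zero is strictly decreasing in the noncentrality parameter: fix σ₀ > 0 and define h : ℝ → ℝ by h(κ) = (1/(√(2π)·σ₀))·exp(−κ²/2) − (κ/σ₀)·Φ(−κ), which equals f(0 | κ, σ₀). Then h is differentiable on ℝ with h'(κ) = −Φ(−κ)/σ₀ for every κ; since Φ(−κ) > 0 for all κ, h' is strictly negative and h is strictly decreasing on ℝ. In particular, for every κ < 0 one has f(0 | κ, σ₀) > f(0 | 0, σ₀) = 1/(√(2π)·σ₀). -/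
open MeasureTheory Filter Real

/-- The standard normal cumulative distribution function
`Φ(t) = (2π)^{−1/2} ∫_{−∞}^{t} exp(−s²/2) ds`. -/
noncomputable def stdNormalCDF (t : ℝ) : ℝ :=
  (Real.sqrt (2 * Real.pi))⁻¹ * ∫ s in Set.Iic t, Real.exp (-s ^ 2 / 2)

/-- The bandit density `f(y | κ, σ₀)`: the asymptotic density of the two-armed-bandit test
statistic with noncentrality parameter `κ`. -/
noncomputable def banditDensity (y κ σ₀ : ℝ) : ℝ :=
  (1 / (Real.sqrt (2 * Real.pi) * σ₀)) * Real.exp (-(|y| - σ₀ * κ) ^ 2 / (2 * σ₀ ^ 2))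
    - (κ / σ₀) * Real.exp (2 * κ * |y| / σ₀) * stdNormalCDF (-|y| / σ₀ - κ)

/-- The bandit density at `y = 0`, as a function of the noncentrality parameter `κ`. -/
noncomputable def banditDensityAtZero (σ₀ κ : ℝ) : ℝ :=
  (1 / (Real.sqrt (2 * Real.pi) * σ₀)) * Real.exp (-κ ^ 2 / 2)
    - (κ / σ₀) * stdNormalCDF (-κ)

theorem integrable_exp_neg_sq_div_two : Integrable fun s : ℝ => Real.exp (-s ^ 2 / 2) := by
  convert integrable_exp_neg_mul_sq (b := 1 / 2) (by norm_num) using 3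
  ring

theorem stdNormalCDF_pos (t : ℝ) : 0 < stdNormalCDF t := by
  have : NeZero (volume.restrict (Set.Iic t)) := ⟨by simp [Measure.restrict_eq_zero]⟩
  exact mul_pos (by positivity) (integral_exp_pos integrable_exp_neg_sq_div_two.integrableOn)

theorem hasDerivAt_stdNormalCDF (t : ℝ) :
    HasDerivAt stdNormalCDF ((Real.sqrt (2 * Real.pi))⁻¹ * Real.exp (-t ^ 2 / 2)) t := by
  have hcont : Continuous fun s : ℝ => Real.exp (-s ^ 2 / 2) := by fun_prop
  have hsplit : stdNormalCDF = fun x => (Real.sqrt (2 * Real.pi))⁻¹ *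
      ((∫ s in Set.Iic 0, Real.exp (-s ^ 2 / 2)) + ∫ s in (0 : ℝ)..x, Real.exp (-s ^ 2 / 2)) := by
    funext x
    rw [← intervalIntegral.integral_Iic_sub_Iic integrable_exp_neg_sq_div_two.integrableOn
      integrable_exp_neg_sq_div_two.integrableOn, add_sub_cancel, stdNormalCDF]
  rw [hsplit]
  exact ((hcont.integral_hasStrictDerivAt 0 t).hasDerivAt.const_add _).const_mul _

theorem banditDensityAtZero_eq (σ₀ κ : ℝ) (hσ₀ : σ₀ ≠ 0) :
    banditDensityAtZero σ₀ κ = banditDensity 0 κ σ₀ := by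
  have hexp : -(|0| - σ₀ * κ) ^ 2 / (2 * σ₀ ^ 2) = -κ ^ 2 / 2 := by
    rw [abs_zero]
    field_simp
    ring
  rw [banditDensity, hexp]
  simp [banditDensityAtZero]

theorem hasDerivAt_banditDensityAtZero (σ₀ κ : ℝ) :
    HasDerivAt (banditDensityAtZero σ₀) (-(stdNormalCDF (-κ)) / σ₀) κ := by
  have hexp : HasDerivAt (fun x : ℝ => Real.exp (-x ^ 2 / 2)) (-κ * Real.exp (-κ ^ 2 / 2)) κ := by
    have h : HasDerivAt (fun x : ℝ => -x ^ 2 / 2) (-κ) κ :=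
      ((hasDerivAt_pow 2 κ).neg.div_const 2).congr_deriv (by norm_num; ring)
    simpa only [mul_comm] using h.exp
  have hcdf := (hasDerivAt_stdNormalCDF (-κ)).comp κ (hasDerivAt_neg κ)
  refine ((hexp.const_mul (1 / (Real.sqrt (2 * Real.pi) * σ₀))).sub
    (((hasDerivAt_id κ).div_const σ₀).mul hcdf)).congr_deriv ?_
  simp only [Function.comp_apply, id_eq, neg_sq, one_div, mul_inv]
  ring

/-- **The bandit density at zero is strictly decreasing in the noncentrality parameter.**
For fixed `σ₀ > 0` and `h(κ) = f(0 | κ, σ₀)`, `h` is differentiable with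
`h'(κ) = −Φ(−κ)/σ₀ < 0`, hence strictly decreasing; in particular for `κ < 0` one has
`f(0 | κ, σ₀) > f(0 | 0, σ₀) = 1/(√(2π)·σ₀)`. -/
theorem banditDensityAtZero_strictAnti (σ₀ : ℝ) (hσ₀ : 0 < σ₀) :
    (∀ κ, banditDensityAtZero σ₀ κ = banditDensity 0 κ σ₀) ∧
    (∀ κ, HasDerivAt (banditDensityAtZero σ₀) (-(stdNormalCDF (-κ)) / σ₀) κ) ∧
    (∀ κ : ℝ, 0 < stdNormalCDF (-κ)) ∧
    (∀ κ, -(stdNormalCDF (-κ)) / σ₀ < 0) ∧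
    StrictAnti (banditDensityAtZero σ₀) ∧
    (∀ κ < (0 : ℝ), banditDensity 0 κ σ₀ > banditDensity 0 0 σ₀) ∧
    banditDensity 0 0 σ₀ = 1 / (Real.sqrt (2 * Real.pi) * σ₀) := by
  have hneg (κ : ℝ) : -(stdNormalCDF (-κ)) / σ₀ < 0 :=
    div_neg_of_neg_of_pos (neg_neg_of_pos (stdNormalCDF_pos _)) hσ₀
  have hanti : StrictAnti (banditDensityAtZero σ₀) :=
    strictAnti_of_hasDerivAt_neg (hasDerivAt_banditDensityAtZero σ₀) hneg
  refine ⟨fun κ => banditDensityAtZero_eq σ₀ κ hσ₀.ne', hasDerivAt_banditDensityAtZero σ₀,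
    fun κ => stdNormalCDF_pos _, hneg, hanti, fun κ hκ => ?_, by simp [banditDensity]⟩
  simpa only [← banditDensityAtZero_eq _ _ hσ₀.ne'] using hanti hκ
end

section
/- Consistency of the two-armed-bandit test against fixed alternatives (analytic form): for every fixed critical value c > 0, the limiting rejection probability G(κ) = 1 − Φ(c − κ) + exp(2κc)·Φ(−κ − c) satisfies lim_{κ → +∞} G(κ) = 1. -/
open MeasureTheory Filter Real

/-- The limiting rejection probability of the two-armed-bandit test with critical value `c`
and noncentrality `κ`: `G(κ) = 1 − Φ(c − κ) + exp(2κc)·Φ(−κ − c)`. -/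
noncomputable def banditRejectProb (c κ : ℝ) : ℝ :=
  1 - stdNormalCDF (c - κ) + Real.exp (2 * κ * c) * stdNormalCDF (-κ - c)

lemma stdNormalCDF_eq_gaussianReal (t : ℝ) :
    stdNormalCDF t = (ProbabilityTheory.gaussianReal 0 1).real (Set.Iic t) := by
  rw [measureReal_def, ProbabilityTheory.gaussianReal_apply_eq_integral 0 one_ne_zero,
    ENNReal.toReal_ofReal
      (integral_nonneg fun x => ProbabilityTheory.gaussianPDFReal_nonneg 0 1 x),
    stdNormalCDF, ← integral_const_mul]
  simp [ProbabilityTheory.gaussianPDFReal]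

lemma stdNormalCDF_nonneg (t : ℝ) : 0 ≤ stdNormalCDF t := by
  rw [stdNormalCDF_eq_gaussianReal]
  exact measureReal_nonneg

/-- The Chernoff bound for the lower tail of the standard normal distribution. -/
lemma stdNormalCDF_le_exp {a : ℝ} (ha : 0 ≤ a) (t : ℝ) :
    stdNormalCDF t ≤ exp (a * t + a ^ 2 / 2) := by
  have h := ProbabilityTheory.measure_le_le_exp_mul_mgf (X := fun x : ℝ => x) (t := -a) t
    (neg_nonpos.mpr ha) (ProbabilityTheory.integrable_exp_mul_gaussianReal (μ := 0) (v := 1) (-a))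
  rw [ProbabilityTheory.mgf_fun_id_gaussianReal, ← exp_add] at h
  rw [stdNormalCDF_eq_gaussianReal]
  simpa [Set.Iic] using h

/-- The standard normal lower tail decays faster than any exponential. -/
lemma tendsto_exp_mul_stdNormalCDF {b : ℝ} (hb : 0 ≤ b) (d : ℝ) :
    Tendsto (fun κ => exp (b * κ) * stdNormalCDF (d - κ)) atTop (nhds 0) := by
  have hlim : Tendsto (fun κ : ℝ => exp ((b + 1) * d + (b + 1) ^ 2 / 2) * exp (-κ))
      atTop (nhds 0) := by
    simpa using tendsto_exp_neg_atTop_nhds_zero.const_mul (exp ((b + 1) * d + (b + 1) ^ 2 / 2))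
  refine squeeze_zero (fun κ => mul_nonneg (exp_pos _).le (stdNormalCDF_nonneg _))
    (fun κ => ?_) hlim
  calc exp (b * κ) * stdNormalCDF (d - κ)
      ≤ exp (b * κ) * exp ((b + 1) * (d - κ) + (b + 1) ^ 2 / 2) := by
        gcongr
        exact stdNormalCDF_le_exp (by positivity) _
    _ = exp ((b + 1) * d + (b + 1) ^ 2 / 2) * exp (-κ) := by
        rw [← exp_add, ← exp_add]
        ring_nf

/-- **Consistency of the two-armed-bandit test against fixed alternatives:** for every fixed
critical value `c > 0`, the limiting rejection probability `G(κ)` tends to `1` as `κ → +∞`. -/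
theorem banditRejectProb_tendsto_one (c : ℝ) (hc : 0 < c) :
    Tendsto (fun κ => banditRejectProb c κ) atTop (nhds 1) := by
  have h₁ : Tendsto (fun κ => stdNormalCDF (c - κ)) atTop (nhds 0) := by
    simpa using tendsto_exp_mul_stdNormalCDF le_rfl c
  have h₂ := tendsto_exp_mul_stdNormalCDF (b := 2 * c) (by positivity) (-c)
  have h := (h₁.const_sub 1).add h₂
  rw [sub_zero, add_zero] at h
  refine h.congr fun κ => ?_
  rw [banditRejectProb, mul_right_comm 2 κ c, show -κ - c = -c - κ by ring]
end

section
/- Validity of the quantile-based p-value aggregation: let B be a positive integer, α ∈ (0, 1], γ ∈ (0, 1], and let p₁, …, p_B be real-valued random variables on a common probability space (with arbitrary dependence) such that P(p_b ≤ u) ≤ u for every u ∈ [0, 1] and every b = 1, …, B. Then P( Σ_{b=1}^{B} 1{p_b ≤ αγ} ≥ γ·B ) ≤ α. (Equivalently: the event that at least a γ-fraction of the individual p-values fall below αγ has probability at most α, so the quantile-aggregated p-value is valid.) -/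
open MeasureTheory Filter

/-- **Validity of the quantile-based p-value aggregation.** If `p₁, …, p_B` are (arbitrarily
dependent) super-uniform p-values, i.e. `P(p_b ≤ u) ≤ u` for all `u ∈ [0,1]`, then for
`α, γ ∈ (0,1]` the event that at least a `γ`-fraction of the p-values fall below `αγ` has
probability at most `α`. -/
theorem quantile_pvalue_aggregation_valid
    {Ω : Type*} [MeasurableSpace Ω] (μ : Measure Ω) [IsProbabilityMeasure μ]
    (B : ℕ) (hB : 0 < B)
    (α γ : ℝ) (hα : α ∈ Set.Ioc (0 : ℝ) 1) (hγ : γ ∈ Set.Ioc (0 : ℝ) 1)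
    (p : Fin B → Ω → ℝ) (hmeas : ∀ b, Measurable (p b))
    (hvalid : ∀ b, ∀ u ∈ Set.Icc (0 : ℝ) 1, μ {ω | p b ω ≤ u} ≤ ENNReal.ofReal u) :
    μ {ω | γ * B ≤ ∑ b, (if p b ω ≤ α * γ then (1 : ℝ) else 0)} ≤ ENNReal.ofReal α := by
  have hset (b : Fin B) : MeasurableSet {ω | p b ω ≤ α * γ} :=
    measurableSet_le (hmeas b) measurable_const
  have hγB : 0 < γ * B := mul_pos hγ.1 (Nat.cast_pos.mpr hB)
  have hαγ : α * γ ∈ Set.Icc (0 : ℝ) 1 :=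
    ⟨(mul_pos hα.1 hγ.1).le, mul_le_one₀ hα.2 hγ.1.le hγ.2⟩
  have hcount (ω : Ω) :
      ENNReal.ofReal (∑ b, (if p b ω ≤ α * γ then (1 : ℝ) else 0)) =
        ∑ b, {ω | p b ω ≤ α * γ}.indicator (1 : Ω → ENNReal) ω := by
    rw [ENNReal.ofReal_sum_of_nonneg fun b _ => by split_ifs <;> norm_num]
    refine Finset.sum_congr rfl fun b _ => ?_
    by_cases h : p b ω ≤ α * γ <;> simp [h]
  have hmarkov := meas_ge_le_lintegral_div (μ := μ)
    (f := fun ω => ∑ b, {ω | p b ω ≤ α * γ}.indicator (1 : Ω → ENNReal) ω)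
    (Finset.measurable_fun_sum _ fun b _ => measurable_one.indicator (hset b)).aemeasurable
    (ENNReal.ofReal_pos.mpr hγB).ne' ENNReal.ofReal_ne_top
  calc
    _ ≤ μ {ω | ENNReal.ofReal (γ * B) ≤
          ∑ b, {ω | p b ω ≤ α * γ}.indicator (1 : Ω → ENNReal) ω} :=
      measure_mono fun ω hω => (ENNReal.ofReal_le_ofReal hω).trans_eq (hcount ω)
    _ ≤ (∑ b, μ {ω | p b ω ≤ α * γ}) / ENNReal.ofReal (γ * B) := by
      refine hmarkov.trans_eq ?_
      rw [lintegral_finsetSum _ fun b _ => measurable_one.indicator (hset b)]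
      simp only [lintegral_indicator_one (hset _)]
    _ ≤ (∑ _b : Fin B, ENNReal.ofReal (α * γ)) / ENNReal.ofReal (γ * B) := by
      gcongr with b
      exact hvalid b _ hαγ
    _ = ENNReal.ofReal α := by
      rw [← ENNReal.ofReal_sum_of_nonneg fun _ _ => hαγ.1, ← ENNReal.ofReal_div_of_pos hγB]
      congr 1
      rw [Finset.sum_const, Finset.card_univ, Fintype.card_fin, nsmul_eq_mul, div_eq_iff hγB.ne']
      ring
end
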